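/- There exist constants 0 < c ≤ C such that for all t ≥ 1, c·√t ≤ ∫₀ᵗ e^{−2v}·I₀(2v) dv ≤ C·√t; in particular, ∫₀ᵗ e^{−2v}·I₀(2v) dv → ∞ as t → ∞. -/

import Mathlib

open MeasureTheory Filter

noncomputable section

/-- The modified Bessel function of the first kind of order zero,
`I₀(x) = ∑_{k=0}^∞ (x/2)^{2k} / (k!)²`. -/
def besselI0 (x : ℝ) : ℝ :=
  ∑' k : ℕ, (x / 2) ^ (2 * k) / ((Nat.factorial k : ℝ)) ^ 2

/-- The modified Bessel function of the first kind of order one,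
`I₁(x) = ∑_{k=0}^∞ (x/2)^{2k+1} / (k!·(k+1)!)`. -/
def besselI1 (x : ℝ) : ℝ :=
  ∑' k : ℕ, (x / 2) ^ (2 * k + 1) / ((Nat.factorial k : ℝ) * (Nat.factorial (k + 1) : ℝ))

/-- The normalized central binomial coefficient `(2k choose k) / 4 ^ k`. -/
def centralBinomRatio (k : ℕ) : ℝ := (Nat.centralBinom k : ℝ) / 4 ^ k

lemma centralBinomRatio_pos (k : ℕ) : 0 < centralBinomRatio k :=
  div_pos (by exact_mod_cast Nat.centralBinom_pos k) (by positivity)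

lemma centralBinomRatio_succ (k : ℕ) :
    centralBinomRatio (k + 1) = (2 * k + 1) / (2 * (k + 1)) * centralBinomRatio k := by
  have h : ((k : ℝ) + 1) * Nat.centralBinom (k + 1) = 2 * (2 * k + 1) * Nat.centralBinom k := by
    exact_mod_cast Nat.succ_mul_centralBinom_succ k
  unfold centralBinomRatio
  rw [pow_succ]
  field_simp
  linarith

lemma sq_centralBinomRatio_mul_le (k : ℕ) : centralBinomRatio k ^ 2 * (k + 1) ≤ 1 := by
  induction k with
  | zero => simp [centralBinomRatio]
  | succ k ih =>
    refine le_trans ?_ ih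
    rw [centralBinomRatio_succ, mul_pow, mul_right_comm, mul_comm]
    refine mul_le_mul_of_nonneg_left ?_ (sq_nonneg _)
    rw [div_pow, div_mul_eq_mul_div, div_le_iff₀ (by positivity)]
    push_cast
    have hk : (0 : ℝ) ≤ k := k.cast_nonneg
    nlinarith [mul_nonneg hk hk]

lemma one_le_sq_centralBinomRatio_mul (k : ℕ) : 1 ≤ centralBinomRatio k ^ 2 * (4 * k + 1) := by
  induction k with
  | zero => simp [centralBinomRatio]
  | succ k ih =>
    refine le_trans ih ?_
    rw [centralBinomRatio_succ, mul_pow, mul_right_comm, mul_comm _ (centralBinomRatio k ^ 2)]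
    refine mul_le_mul_of_nonneg_left ?_ (sq_nonneg _)
    rw [div_pow, div_mul_eq_mul_div, le_div_iff₀ (by positivity)]
    push_cast
    have hk : (0 : ℝ) ≤ k := k.cast_nonneg
    nlinarith [mul_nonneg hk hk]

lemma centralBinomRatio_le {s : ℝ} (hs : 0 < s) (k : ℕ) :
    centralBinomRatio k ≤ (s / (k + 1) + 1 / s) / 2 := by
  have hp := centralBinomRatio_pos k
  have hm : (0 : ℝ) < k + 1 := by positivity
  refine (sq_le_sq₀ (by positivity) (by positivity)).1 ?_
  have h1 : centralBinomRatio k ^ 2 ≤ 1 / (k + 1) :=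
    (le_div_iff₀ hm).2 (sq_centralBinomRatio_mul_le k)
  have h2 : ((s / (k + 1) + 1 / s) / 2) ^ 2 = 1 / (k + 1) + ((s / (k + 1) - 1 / s) / 2) ^ 2 := by
    field_simp
    ring
  rw [h2]
  linarith [sq_nonneg ((s / ((k : ℝ) + 1) - 1 / s) / 2)]

lemma le_centralBinomRatio {s : ℝ} (hs : 0 < s) (k : ℕ) :
    (3 / s - (k + 1) / s ^ 3) / 4 ≤ centralBinomRatio k := by
  have hp := centralBinomRatio_pos k
  set p := centralBinomRatio k
  set r := √((k : ℝ) + 1)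
  have hr0 : 0 < r := Real.sqrt_pos.2 (by positivity)
  have hr2 : r ^ 2 = k + 1 := Real.sq_sqrt (by positivity)
  have h1 : 1 ≤ p * (2 * r) := by
    refine (sq_le_sq₀ (by positivity) (by positivity)).1 ?_
    have : 1 ≤ p ^ 2 * (4 * k + 1) := one_le_sq_centralBinomRatio_mul k
    rw [mul_pow, mul_pow, hr2]
    nlinarith [sq_nonneg p]
  have h2 : 1 / (2 * r) ≤ p := (div_le_iff₀ (by positivity)).2 h1
  refine le_trans ?_ h2
  rw [← hr2, ← sub_nonneg]
  have : 1 / (2 * r) - (3 / s - r ^ 2 / s ^ 3) / 4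
      = (s - r) ^ 2 * (2 * s + r) / (4 * r * s ^ 3) := by
    field_simp
    ring
  rw [this]
  positivity

lemma besselI0_term_eq (x : ℝ) (k : ℕ) :
    (x / 2) ^ (2 * k) / (k.factorial : ℝ) ^ 2
      = x ^ (2 * k) / ((2 * k).factorial : ℝ) * centralBinomRatio k := by
  have h : (Nat.centralBinom k : ℝ) * k.factorial * k.factorial = (2 * k).factorial := by
    have := Nat.choose_mul_factorial_mul_factorial (show k ≤ 2 * k by omega)
    rw [show 2 * k - k = k by omega] at this
    exact_mod_cast this
  rw [centralBinomRatio, ← h, div_pow, pow_mul 2]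
  have := Nat.centralBinom_ne_zero k
  field_simp
  norm_num

lemma besselI0_term_nonneg (x : ℝ) (k : ℕ) :
    0 ≤ (x / 2) ^ (2 * k) / (k.factorial : ℝ) ^ 2 := by
  rw [pow_mul]; positivity

lemma summable_besselI0 (x : ℝ) :
    Summable fun k : ℕ => (x / 2) ^ (2 * k) / (k.factorial : ℝ) ^ 2 := by
  refine Summable.of_nonneg_of_le (besselI0_term_nonneg x) (fun k => ?_)
    (Real.hasSum_cosh x).summable
  rw [besselI0_term_eq]
  refine mul_le_of_le_one_right (by rw [pow_mul]; positivity) ?_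
  exact div_le_one_of_le₀ (by exact_mod_cast Nat.centralBinom_le_four_pow k) (by positivity)

lemma monotoneOn_besselI0 : MonotoneOn besselI0 (Set.Ici 0) := by
  intro x hx y hy hxy
  refine (summable_besselI0 x).tsum_le_tsum (fun k => ?_) (summable_besselI0 y)
  have : (0 : ℝ) ≤ x := hx
  gcongr

lemma hasSum_natCast_mul_cosh (x : ℝ) :
    HasSum (fun k : ℕ => (k : ℝ) * (x ^ (2 * k) / ((2 * k).factorial : ℝ)))
      (x / 2 * Real.sinh x) := by
  rw [← hasSum_nat_add_iff' 1]
  simp only [Finset.sum_range_one, Nat.cast_zero, zero_mul, sub_zero]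
  have h : (fun k : ℕ => ((k + 1 : ℕ) : ℝ) * (x ^ (2 * (k + 1)) / ((2 * (k + 1)).factorial : ℝ)))
      = fun k : ℕ => x / 2 * (x ^ (2 * k + 1) / ((2 * k + 1).factorial : ℝ)) := by
    funext k
    rw [show 2 * (k + 1) = 2 * k + 1 + 1 by ring, Nat.factorial_succ (2 * k + 1), pow_succ]
    push_cast
    field_simp
    ring
  rw [h]
  exact (Real.hasSum_sinh x).mul_left (x / 2)

lemma besselI0_le {x : ℝ} (hx : 0 < x) : besselI0 x ≤ Real.exp x / √x := by
  have hs : 0 < √x := Real.sqrt_pos.2 hx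
  have hsum := ((Real.hasSum_sinh x).mul_left (1 / √x)).add
    ((Real.hasSum_cosh x).mul_left (1 / (2 * √x)))
  have h : besselI0 x ≤ 1 / √x * Real.sinh x + 1 / (2 * √x) * Real.cosh x := by
    refine hasSum_le (fun k => ?_) (summable_besselI0 x).hasSum hsum
    rw [besselI0_term_eq]
    refine (mul_le_mul_of_nonneg_left (centralBinomRatio_le hs k) (by positivity)).trans ?_
    have hx2 : x = √x ^ 2 := (Real.sq_sqrt hx.le).symm
    have key : x ^ (2 * k) / ((2 * k).factorial : ℝ) * (√x / (k + 1))
        ≤ 2 * (1 / √x * (x ^ (2 * k + 1) / ((2 * k + 1).factorial : ℝ))) := by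
      have e : 2 * (1 / √x * (x ^ (2 * k + 1) / ((2 * k + 1).factorial : ℝ)))
          = x ^ (2 * k) / ((2 * k).factorial : ℝ) * (√x * (2 / (2 * k + 1))) := by
        rw [Nat.factorial_succ, pow_succ]
        push_cast
        field_simp
        rw [Real.sq_sqrt hx.le]
      rw [e]
      refine mul_le_mul_of_nonneg_left ?_ (by positivity)
      rw [div_eq_mul_one_div]
      refine mul_le_mul_of_nonneg_left ?_ hs.le
      rw [div_le_div_iff₀ (by positivity) (by positivity)]
      linarith
    have e2 : x ^ (2 * k) / ((2 * k).factorial : ℝ) * (1 / √x)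
        = 2 * (1 / (2 * √x) * (x ^ (2 * k) / ((2 * k).factorial : ℝ))) := by
      field_simp
    linarith
  refine h.trans ?_
  have e : 1 / √x * Real.sinh x + 1 / (2 * √x) * Real.cosh x
      = (Real.sinh x + Real.cosh x / 2) / √x := by
    field_simp
  rw [e]
  gcongr
  rw [Real.sinh_eq, Real.cosh_eq]
  linarith [Real.exp_pos x, Real.exp_pos (-x)]

lemma le_besselI0 {x : ℝ} (hx : 0 ≤ x) : Real.exp x / (4 * √(1 + x / 2)) ≤ besselI0 x := by
  set s := √(1 + x / 2)
  have hs : 0 < s := Real.sqrt_pos.2 (by positivity)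
  have hs2 : s ^ 2 = 1 + x / 2 := Real.sq_sqrt (by positivity)
  have hsum := (((Real.hasSum_cosh x).mul_left (3 / s)).sub
    (((hasSum_natCast_mul_cosh x).add (Real.hasSum_cosh x)).mul_left (1 / s ^ 3))).div_const 4
  have h : (3 / s * Real.cosh x - 1 / s ^ 3 * (x / 2 * Real.sinh x + Real.cosh x)) / 4
      ≤ besselI0 x := by
    refine hasSum_le (fun k => ?_) hsum (summable_besselI0 x).hasSum
    rw [besselI0_term_eq]
    refine le_trans (le_of_eq ?_)
      (mul_le_mul_of_nonneg_left (le_centralBinomRatio hs k) (by positivity))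
    ring
  refine le_trans ?_ h
  have h1 : x / 2 * Real.sinh x + Real.cosh x ≤ s ^ 2 * Real.cosh x := by
    rw [hs2]
    nlinarith [mul_le_mul_of_nonneg_left (Real.sinh_lt_cosh x).le hx]
  have h2 : 1 / s ^ 3 * (x / 2 * Real.sinh x + Real.cosh x) ≤ 1 / s * Real.cosh x := by
    refine (mul_le_mul_of_nonneg_left h1 (by positivity)).trans (le_of_eq ?_)
    field_simp
  have h3 : Real.exp x / (4 * s) ≤ 1 / s * Real.cosh x / 2 := by
    have : 1 / s * Real.cosh x / 2 = (2 * Real.cosh x) / (4 * s) := by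
      field_simp
      norm_num
    rw [this]
    gcongr
    rw [Real.cosh_eq]
    linarith [Real.exp_pos (-x)]
  have h4 : 3 / s * Real.cosh x = 3 * (1 / s * Real.cosh x) := by ring
  linarith

lemma exp_mul_besselI0_le {v : ℝ} (hv : 0 < v) :
    Real.exp (-2 * v) * besselI0 (2 * v) ≤ v ^ (-(1 / 2) : ℝ) := by
  calc Real.exp (-2 * v) * besselI0 (2 * v)
      ≤ Real.exp (-2 * v) * (Real.exp (2 * v) / √(2 * v)) := by
        gcongr
        exact besselI0_le (by positivity)
    _ = 1 / √(2 * v) := by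
        rw [← mul_div_assoc, ← Real.exp_add]
        simp
    _ ≤ 1 / √v := by
        gcongr
        linarith
    _ = v ^ (-(1 / 2) : ℝ) := by
        rw [Real.rpow_neg hv.le, ← Real.sqrt_eq_rpow, one_div]

lemma le_exp_mul_besselI0 {v : ℝ} (hv : 0 ≤ v) :
    1 / (4 * √(1 + v)) ≤ Real.exp (-2 * v) * besselI0 (2 * v) := by
  calc 1 / (4 * √(1 + v))
      = Real.exp (-2 * v) * (Real.exp (2 * v) / (4 * √(1 + 2 * v / 2))) := by
        rw [← mul_div_assoc, ← Real.exp_add]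
        simp
    _ ≤ Real.exp (-2 * v) * besselI0 (2 * v) := by
        gcongr
        exact le_besselI0 (by positivity)

lemma intervalIntegrable_exp_mul_besselI0 {t : ℝ} (ht : 0 ≤ t) :
    IntervalIntegrable (fun v => Real.exp (-2 * v) * besselI0 (2 * v)) volume 0 t := by
  refine IntervalIntegrable.continuousOn_mul (MonotoneOn.intervalIntegrable ?_)
    (Continuous.continuousOn (by fun_prop))
  rw [Set.uIcc_of_le ht]
  intro x hx y hy hxy
  exact monotoneOn_besselI0 (mul_nonneg zero_le_two hx.1) (mul_nonneg zero_le_two hy.1)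
    (by linarith)

lemma integral_exp_mul_besselI0_le {t : ℝ} (ht : 0 ≤ t) :
    (∫ v in (0:ℝ)..t, Real.exp (-2 * v) * besselI0 (2 * v)) ≤ 2 * √t := by
  have hr : (-1 : ℝ) < -(1 / 2) := by norm_num
  calc (∫ v in (0:ℝ)..t, Real.exp (-2 * v) * besselI0 (2 * v))
      ≤ ∫ v in (0:ℝ)..t, v ^ (-(1 / 2) : ℝ) :=
        intervalIntegral.integral_mono_on_of_le_Ioo ht (intervalIntegrable_exp_mul_besselI0 ht)
          (intervalIntegral.intervalIntegrable_rpow' hr)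
          fun v hv => exp_mul_besselI0_le hv.1
    _ = 2 * √t := by
        rw [integral_rpow (Or.inl hr), Real.sqrt_eq_rpow]
        norm_num
        ring

lemma le_integral_exp_mul_besselI0 {t : ℝ} (ht : 1 ≤ t) :
    1 / 8 * √t ≤ ∫ v in (0:ℝ)..t, Real.exp (-2 * v) * besselI0 (2 * v) := by
  have ht0 : 0 ≤ t := zero_le_one.trans ht
  have hs : 0 < √t := Real.sqrt_pos.2 (by linarith)
  have hbound : √(1 + t) ≤ 2 * √t := by
    rw [Real.sqrt_le_left (by positivity), mul_pow, Real.sq_sqrt ht0]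
    linarith
  calc 1 / 8 * √t = t * (1 / (4 * (2 * √t))) := by
        nth_rewrite 2 [← Real.sq_sqrt ht0]
        field_simp
        norm_num
    _ ≤ t * (1 / (4 * √(1 + t))) := by gcongr
    _ = ∫ _ in (0:ℝ)..t, 1 / (4 * √(1 + t)) := by
        rw [intervalIntegral.integral_const, sub_zero, smul_eq_mul]
    _ ≤ ∫ v in (0:ℝ)..t, Real.exp (-2 * v) * besselI0 (2 * v) := by
        refine intervalIntegral.integral_mono_on ht0 intervalIntegrable_const
          (intervalIntegrable_exp_mul_besselI0 ht0) fun v hv => ?_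
        refine le_trans ?_ (le_exp_mul_besselI0 hv.1)
        have := hv.1
        gcongr
        exact hv.2

/-- growth of order `√t` of the variance of the pure directed chain:
there exist constants `0 < c ≤ C` such that `c·√t ≤ ∫₀ᵗ e^{-2v}·I₀(2v) dv ≤ C·√t` for all
`t ≥ 1`; in particular the integral tends to `∞` as `t → ∞`. -/
theorem statement11 :
    (∃ c C : ℝ, 0 < c ∧ c ≤ C ∧
      ∀ t : ℝ, 1 ≤ t →
        c * Real.sqrt t ≤ (∫ v in (0:ℝ)..t, Real.exp (-2 * v) * besselI0 (2 * v)) ∧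
        (∫ v in (0:ℝ)..t, Real.exp (-2 * v) * besselI0 (2 * v)) ≤ C * Real.sqrt t) ∧
    Filter.Tendsto (fun t : ℝ => ∫ v in (0:ℝ)..t, Real.exp (-2 * v) * besselI0 (2 * v))
      Filter.atTop Filter.atTop := by
  refine ⟨⟨1 / 8, 2, by norm_num, by norm_num, fun t ht =>
    ⟨le_integral_exp_mul_besselI0 ht, integral_exp_mul_besselI0_le (by linarith)⟩⟩, ?_⟩
  refine tendsto_atTop_mono' _ ((eventually_ge_atTop 1).mono fun t ht =>
    le_integral_exp_mul_besselI0 ht) ?_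
  exact Real.tendsto_sqrt_atTop.const_mul_atTop (by norm_num)
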